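/- arXiv:2605.18600 — 4 statements merged into one kernel-verified Lean document; each statement's English description precedes it below -/
import Mathlib

section
/- For all real parameters α ≥ 0 with α ≠ 1 and β ≠ 1, the Sharma–Mittal entropy S_{α,β} is Schur-concave on the probability simplex: for all p, q ∈ P_n with p majorized by q, one has S_{α,β}(q) ≤ S_{α,β}(p). -/
open Finset Real

/-- `p` is a probability vector: nonnegative, non-increasing entries summing to 1. -/
def IsProbVec {n : ℕ} (p : Fin n → ℝ) : Prop :=
  (∀ i, 0 ≤ p i) ∧ (∀ i j : Fin n, i ≤ j → p j ≤ p i) ∧ ∑ i, p i = 1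

/-- The sum of the first `k` entries of `p`. -/
noncomputable def partialSum {n : ℕ} (p : Fin n → ℝ) (k : ℕ) : ℝ :=
  ∑ i : Fin n, if (i : ℕ) < k then p i else 0

/-- `p` is majorized by `q` (`p ⪯ q`). -/
def MajorizedBy {n : ℕ} (p q : Fin n → ℝ) : Prop :=
  ∀ k : ℕ, k ≤ n → partialSum p k ≤ partialSum q k

/-- The Sharma–Mittal entropy of order `(α, β)`. -/
noncomputable def sharmaMittal (α β : ℝ) {n : ℕ} (p : Fin n → ℝ) : ℝ :=
  (1 / (1 - β)) * ((∑ i, p i ^ α) ^ ((1 - β) / (1 - α)) - 1)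

theorem partialSum_castSucc {n k : ℕ} (hk : k ≤ n) (d : Fin (n + 1) → ℝ) :
    partialSum (fun i : Fin n => d i.castSucc) k = partialSum d k := by
  simp [partialSum, Fin.sum_univ_castSucc, hk]

theorem partialSum_self {n : ℕ} (d : Fin n → ℝ) : partialSum d n = ∑ i, d i := by
  simp [partialSum]

/-- Abel's inequality: a lower bound for the pairing of an antitone sequence with a sequence
whose partial sums are nonnegative. -/
theorem mul_sum_le_sum_mul_of_antitone {n : ℕ} {c d : Fin n → ℝ} {e : ℝ} (hc : Antitone c)
    (he : ∀ i, e ≤ c i) (hd : ∀ k ≤ n, 0 ≤ partialSum d k) :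
    e * ∑ i, d i ≤ ∑ i, c i * d i := by
  induction n generalizing e with
  | zero => simp
  | succ n ih =>
    have h := ih (c := fun i => c i.castSucc) (d := fun i => d i.castSucc) (e := c (Fin.last n))
      (fun i j hij => hc (Fin.castSucc_le_castSucc_iff.2 hij)) (fun i => hc (Fin.le_last _))
      (fun k hk => by rw [partialSum_castSucc hk]; exact hd k (by lia))
    have h0 := hd (n + 1) le_rfl
    rw [partialSum_self] at h0
    have h1 := mul_le_mul_of_nonneg_right (he (Fin.last n)) h0
    rw [Fin.sum_univ_castSucc (fun i => c i * d i)]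
    rw [Fin.sum_univ_castSucc d] at h1 ⊢
    linarith

theorem sum_mul_nonneg_of_antitone {n : ℕ} {c d : Fin n → ℝ} (hc : Antitone c)
    (hd : ∀ k ≤ n, 0 ≤ partialSum d k) (hsum : ∑ i, d i = 0) : 0 ≤ ∑ i, c i * d i := by
  cases n with
  | zero => simp
  | succ n =>
    simpa [hsum] using mul_sum_le_sum_mul_of_antitone hc (fun i => hc (Fin.le_last i)) hd

/-- The tangent line inequality for the convex function `x ↦ x ^ α / (α - 1)`. -/
theorem rpow_div_sub_one_tangent_le {α x y : ℝ} (hα0 : 0 ≤ α) (hx : 0 < x) (hy : 0 ≤ y) :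
    x ^ α / (α - 1) + α * x ^ (α - 1) / (α - 1) * (y - x) ≤ y ^ α / (α - 1) := by
  have hs : -1 ≤ y / x - 1 := by linarith [div_nonneg hy hx.le]
  have hpow : x ^ α * (1 + (y / x - 1)) ^ α = y ^ α := by
    rw [add_sub_cancel, ← mul_rpow hx.le (div_nonneg hy hx.le), mul_div_cancel₀ _ hx.ne']
  have hlin : x ^ α * (1 + α * (y / x - 1)) = x ^ α + α * x ^ (α - 1) * (y - x) := by
    rw [rpow_sub_one hx.ne']
    field_simp
  rw [div_mul_eq_mul_div, ← add_div, ← hlin, ← hpow]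
  have hxα := rpow_nonneg hx.le α
  rcases le_total 1 α with h | h
  · exact div_le_div_of_nonneg_right
      (mul_le_mul_of_nonneg_left (one_add_mul_self_le_rpow_one_add hs h) hxα) (by linarith)
  · exact div_le_div_of_nonpos_of_le (by linarith)
      (mul_le_mul_of_nonneg_left (rpow_one_add_le_one_add_mul_self hs hα0 h) hxα)

theorem monotoneOn_rpow_sub_one_div {α : ℝ} (hα0 : 0 ≤ α) :
    MonotoneOn (fun x : ℝ => α * x ^ (α - 1) / (α - 1)) (Set.Ioi 0) := by
  intro x hx y hy hxy
  rw [Set.mem_Ioi] at hx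
  rcases le_total 1 α with h | h
  · exact div_le_div_of_nonneg_right (mul_le_mul_of_nonneg_left
      (rpow_le_rpow hx.le hxy (by linarith)) hα0) (by linarith)
  · exact div_le_div_of_nonpos_of_le (by linarith) (mul_le_mul_of_nonneg_left
      (rpow_le_rpow_of_nonpos hx hxy (by linarith)) hα0)

theorem MajorizedBy.partialSum_sub_nonneg {n : ℕ} {p q : Fin n → ℝ} (h : MajorizedBy p q) :
    ∀ k ≤ n, 0 ≤ partialSum (fun i => q i - p i) k := by
  intro k hk
  have : partialSum (fun i => q i - p i) k = partialSum q k - partialSum p k := by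
    simp only [partialSum, ← Finset.sum_sub_distrib]
    exact Finset.sum_congr rfl fun i _ => by split_ifs <;> simp
  rw [this]
  exact sub_nonneg.2 (h k hk)

/-- Karamata's inequality for `x ↦ x ^ α / (α - 1)` after a positive shift of both vectors. -/
theorem MajorizedBy.sum_shifted_rpow_div_le {n : ℕ} {p q : Fin n → ℝ} {α ε : ℝ}
    (h : MajorizedBy p q) (hα0 : 0 ≤ α) (hp0 : ∀ i, 0 ≤ p i) (hp : Antitone p)
    (hq0 : ∀ i, 0 ≤ q i) (hsum : ∑ i, p i = ∑ i, q i) (hε : 0 < ε) :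
    (∑ i, (p i + ε) ^ α) / (α - 1) ≤ (∑ i, (q i + ε) ^ α) / (α - 1) := by
  have hpos : ∀ i, 0 < p i + ε := fun i => add_pos_of_nonneg_of_pos (hp0 i) hε
  have hc : Antitone fun i => α * (p i + ε) ^ (α - 1) / (α - 1) := fun i j hij =>
    monotoneOn_rpow_sub_one_div hα0 (hpos j) (hpos i) (by linarith [hp hij])
  have habel := sum_mul_nonneg_of_antitone hc h.partialSum_sub_nonneg
    (by rw [Finset.sum_sub_distrib, hsum, sub_self])
  have htan := Finset.sum_le_sum fun i (_ : i ∈ Finset.univ) =>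
    rpow_div_sub_one_tangent_le hα0 (hpos i) (add_nonneg (hq0 i) hε.le)
  simp only [add_sub_add_right_eq_sub, Finset.sum_add_distrib] at htan
  rw [Finset.sum_div, Finset.sum_div]
  linarith

/-- Karamata's inequality for the convex function `x ↦ x ^ α / (α - 1)`. -/
theorem MajorizedBy.sum_rpow_div_le {n : ℕ} {p q : Fin n → ℝ} {α : ℝ}
    (h : MajorizedBy p q) (hα0 : 0 ≤ α) (hp0 : ∀ i, 0 ≤ p i) (hp : Antitone p)
    (hq0 : ∀ i, 0 ≤ q i) (hsum : ∑ i, p i = ∑ i, q i) :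
    (∑ i, p i ^ α) / (α - 1) ≤ (∑ i, q i ^ α) / (α - 1) := by
  have hlim : ∀ r : Fin n → ℝ, Filter.Tendsto (fun ε : ℝ => (∑ i, (r i + ε) ^ α) / (α - 1))
      (nhdsWithin 0 (Set.Ioi 0)) (nhds ((∑ i, r i ^ α) / (α - 1))) := by
    intro r
    have hcont : Continuous fun ε : ℝ => (∑ i, (r i + ε) ^ α) / (α - 1) :=
      (continuous_finsetSum _ fun i _ =>
        (continuous_const.add continuous_id).rpow_const fun _ => Or.inr hα0).div_const _
    simpa using (hcont.tendsto 0).mono_left nhdsWithin_le_nhds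
  exact le_of_tendsto_of_tendsto (hlim p) (hlim q) (eventually_nhdsWithin_of_forall
    fun _ hε => h.sum_shifted_rpow_div_le hα0 hp0 hp hq0 hsum hε)

theorem IsProbVec.sum_rpow_pos {n : ℕ} {p : Fin n → ℝ} (hp : IsProbVec p) (α : ℝ) :
    0 < ∑ i, p i ^ α := by
  obtain ⟨i, -, hi⟩ := Finset.exists_lt_of_sum_lt
    (show ∑ _i : Fin n, (0 : ℝ) < ∑ i, p i by simp [hp.2.2])
  exact Finset.sum_pos' (fun j _ => rpow_nonneg (hp.1 j) α)
    ⟨i, Finset.mem_univ i, rpow_pos_of_pos hi α⟩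

/-- For `α ≥ 0`, `α ≠ 1`, `β ≠ 1`, the Sharma–Mittal entropy is Schur-concave on the
probability simplex. -/
theorem sharmaMittal_schur_concave {n : ℕ} (α β : ℝ) (hα0 : 0 ≤ α) (hα1 : α ≠ 1)
    (hβ1 : β ≠ 1) (p q : Fin n → ℝ) (hp : IsProbVec p) (hq : IsProbVec q)
    (hmaj : MajorizedBy p q) :
    sharmaMittal α β q ≤ sharmaMittal α β p := by
  have hP := hp.sum_rpow_pos α
  have hQ := hq.sum_rpow_pos α
  have hK := hmaj.sum_rpow_div_le hα0 hp.1 (fun i j hij => hp.2.1 i j hij) hq.1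
    (hp.2.2.trans hq.2.2.symm)
  unfold sharmaMittal
  rcases lt_or_gt_of_ne hα1 with hα | hα
  · rw [div_le_div_right_of_neg (by linarith)] at hK
    rcases lt_or_gt_of_ne hβ1 with hβ | hβ
    · exact mul_le_mul_of_nonneg_left (sub_le_sub_right (rpow_le_rpow hQ.le hK
        (div_nonneg (by linarith) (by linarith))) 1) (one_div_nonneg.2 (by linarith))
    · exact mul_le_mul_of_nonpos_left (sub_le_sub_right (rpow_le_rpow_of_nonpos hQ hK
        (div_nonpos_of_nonpos_of_nonneg (by linarith) (by linarith))) 1)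
        (one_div_nonpos.2 (by linarith))
  · rw [div_le_div_iff_of_pos_right (by linarith)] at hK
    rcases lt_or_gt_of_ne hβ1 with hβ | hβ
    · exact mul_le_mul_of_nonneg_left (sub_le_sub_right (rpow_le_rpow_of_nonpos hP hK
        (div_nonpos_of_nonneg_of_nonpos (by linarith) (by linarith))) 1)
        (one_div_nonneg.2 (by linarith))
    · exact mul_le_mul_of_nonpos_left (sub_le_sub_right (rpow_le_rpow hP.le hK
        (div_nonneg_of_nonpos (by linarith) (by linarith))) 1) (one_div_nonpos.2 (by linarith))
end

section
/- For all real parameters α < 0 and β ≠ 1, the Sharma–Mittal entropy S_{α,β} is Schur-convex on the set of strictly positive probability vectors: for all p, q ∈ P_n with strictly positive entries and p majorized by q, one has S_{α,β}(p) ≤ S_{α,β}(q). -/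
open Finset Real

/-- Abel summation: if the weights `c` are antitone and the partial sums of `d` are nonnegative,
then `∑ i, c i * d i` is at least the last weight times the total. -/
theorem last_mul_sum_le_sum_mul {n : ℕ} (c d : Fin (n + 1) → ℝ) (hc : Antitone c)
    (hd : ∀ k, k ≤ n + 1 → 0 ≤ partialSum d k) :
    c (Fin.last n) * ∑ i, d i ≤ ∑ i, c i * d i := by
  induction n with
  | zero => simp
  | succ n ih =>
    have hsum : 0 ≤ ∑ i : Fin (n + 1), d i.castSucc := by
      have h := hd (n + 1) (by omega)
      unfold partialSum at h
      rw [Fin.sum_univ_castSucc] at h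
      simpa [Nat.le_of_lt_succ (Fin.is_lt _)] using h
    have hinit := ih (fun i => c i.castSucc) (fun i => d i.castSucc)
      (fun i j hij => hc (Fin.castSucc_le_castSucc_iff.mpr hij)) (fun k hk => by
        have h := hd k (by omega)
        unfold partialSum at h ⊢
        rw [Fin.sum_univ_castSucc] at h
        simpa [not_lt.mpr hk] using h)
    rw [Fin.sum_univ_castSucc, Fin.sum_univ_castSucc (fun i => c i * d i), mul_add]
    have hlast : c (Fin.last (n + 1)) ≤ c (Fin.last n).castSucc := hc (Fin.le_last _)
    have := mul_le_mul_of_nonneg_right hlast hsum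
    linarith

/-- If the weights `c` are antitone and `p` is majorized by `q` with the same total, then
`∑ i, c i * (q i - p i)` is nonnegative. -/
theorem MajorizedBy.sum_mul_sub_nonneg {n : ℕ} {p q : Fin n → ℝ} (h : MajorizedBy p q)
    (hsum : ∑ i, p i = ∑ i, q i) {c : Fin n → ℝ} (hc : Antitone c) :
    0 ≤ ∑ i, c i * (q i - p i) := by
  cases n with
  | zero => simp
  | succ n =>
    have key := last_mul_sum_le_sum_mul c (fun i => q i - p i) hc (fun k hk => by
      have hpq := sub_nonneg.mpr (h k hk)
      unfold partialSum at hpq ⊢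
      rw [← Finset.sum_sub_distrib] at hpq
      refine hpq.trans_eq (Finset.sum_congr rfl fun i _ => ?_)
      split_ifs <;> simp)
    rwa [Finset.sum_sub_distrib, hsum, sub_self, mul_zero] at key

/-- For a negative exponent, `x ↦ x ^ α` lies above its tangent lines on the positive reals. -/
theorem rpow_add_mul_sub_le_rpow_of_neg {α x y : ℝ} (hα : α < 0) (hx : 0 < x) (hy : 0 < y) :
    x ^ α + α * x ^ (α - 1) * (y - x) ≤ y ^ α := by
  have ht : 0 < y / x := div_pos hy hx
  have hB : 1 + α * (y / x - 1) ≤ (y / x) ^ α := by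
    rw [Real.rpow_def_of_pos ht, mul_comm (Real.log _)]
    have hexp := Real.add_one_le_exp (α * Real.log (y / x))
    have hlog := mul_le_mul_of_nonpos_left (Real.log_le_sub_one_of_pos ht) hα.le
    linarith
  rw [Real.div_rpow hy.le hx.le, le_div_iff₀ (Real.rpow_pos_of_pos hx α)] at hB
  refine le_trans (le_of_eq ?_) hB
  rw [Real.rpow_sub_one hx.ne']
  field_simp

/-- Power sums with a negative exponent are Schur-convex on strictly positive vectors. -/
theorem MajorizedBy.sum_rpow_le_sum_rpow_of_neg {n : ℕ} {p q : Fin n → ℝ} (h : MajorizedBy p q)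
    (hsum : ∑ i, p i = ∑ i, q i) (hp : Antitone p) (hppos : ∀ i, 0 < p i)
    (hqpos : ∀ i, 0 < q i) {α : ℝ} (hα : α < 0) :
    ∑ i, p i ^ α ≤ ∑ i, q i ^ α := by
  have hc : Antitone fun i => α * p i ^ (α - 1) := fun i j hij =>
    mul_le_mul_of_nonpos_left
      (Real.rpow_le_rpow_of_nonpos (hppos j) (hp hij) (by linarith)) hα.le
  have hle := Finset.sum_le_sum fun i (_ : i ∈ Finset.univ) =>
    rpow_add_mul_sub_le_rpow_of_neg hα (hppos i) (hqpos i)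
  rw [Finset.sum_add_distrib] at hle
  linarith [h.sum_mul_sub_nonneg hsum hc]

/-- For `α < 0`, `β ≠ 1`, the Sharma–Mittal entropy is Schur-convex on the set of
strictly positive probability vectors. -/
theorem sharmaMittal_schur_convex {n : ℕ} (α β : ℝ) (hα : α < 0) (hβ1 : β ≠ 1)
    (p q : Fin n → ℝ) (hp : IsProbVec p) (hq : IsProbVec q)
    (hppos : ∀ i, 0 < p i) (hqpos : ∀ i, 0 < q i)
    (hmaj : MajorizedBy p q) :
    sharmaMittal α β p ≤ sharmaMittal α β q := by
  have hle : ∑ i, p i ^ α ≤ ∑ i, q i ^ α :=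
    hmaj.sum_rpow_le_sum_rpow_of_neg (hp.2.2.trans hq.2.2.symm) (fun i j => hp.2.1 i j)
      hppos hqpos hα
  have hne : (Finset.univ : Finset (Fin n)).Nonempty := by
    by_contra hempty
    have hsum := hp.2.2
    rw [Finset.not_nonempty_iff_eq_empty.mp hempty, Finset.sum_empty] at hsum
    exact zero_ne_one hsum
  have hpos : 0 < ∑ i, p i ^ α :=
    Finset.sum_pos (fun i _ => Real.rpow_pos_of_pos (hppos i) α) hne
  unfold sharmaMittal
  rcases lt_or_gt_of_ne hβ1 with hβ | hβ
  · exact mul_le_mul_of_nonneg_left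
      (sub_le_sub_right (Real.rpow_le_rpow hpos.le hle
        (div_nonneg (by linarith) (by linarith))) 1)
      (one_div_nonneg.mpr (by linarith))
  · exact mul_le_mul_of_nonpos_left
      (sub_le_sub_right (Real.rpow_le_rpow_of_nonpos hpos hle
        (div_nonpos_of_nonpos_of_nonneg (by linarith) (by linarith))) 1)
      (one_div_nonpos.mpr (by linarith))
end

section
/- Let p, q ∈ P_n and let r ∈ P_n satisfy Σ_{i=1}^k r_i = min(Σ_{i=1}^k p_i, Σ_{i=1}^k q_i) for all k = 1, …, n (so r is the greatest lower bound p ∧ q in the majorization lattice). Then the product distribution p ⊗ q is majorized by r: for every subset A of pairs (i, j) ∈ {1,…,n} × {1,…,n}, Σ_{(i,j)∈A} p_i q_j ≤ Σ_{i=1}^{min(|A|, n)} r_i. -/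
open Finset Real

/-- The partial sums of a non-increasing nonnegative vector dominate the sum over every index set
of at most the same size. -/
theorem sum_le_partialSum {n : ℕ} {p : Fin n → ℝ} (h0 : ∀ i, 0 ≤ p i)
    (hanti : ∀ i j : Fin n, i ≤ j → p j ≤ p i) {k : ℕ} (hk : k ≤ n) {S : Finset (Fin n)}
    (hS : S.card ≤ k) : ∑ i ∈ S, p i ≤ partialSum p k := by
  rcases hk.lt_or_eq with hlt | rfl
  · set c := p ⟨k, hlt⟩ with hc
    have hcard : (univ.filter fun i : Fin n => (i : ℕ) < k).card = k := by
      rw [Fin.card_filter_val_lt, min_eq_right hk]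
    have hpos : ∑ i ∈ S, (p i - c) ≤ ∑ i : Fin n, if (i : ℕ) < k then p i - c else 0 := by
      rw [← Finset.sum_filter_add_sum_filter_not univ (fun i => i ∈ S), Finset.filter_mem_eq_inter,
        Finset.univ_inter]
      refine le_add_of_le_of_nonneg (Finset.sum_le_sum fun i _ => ?_)
        (Finset.sum_nonneg fun i _ => ?_)
      · split_ifs with h
        · exact le_rfl
        · exact sub_nonpos.2 (hanti ⟨k, hlt⟩ i (not_lt.1 h))
      · split_ifs with h
        · exact sub_nonneg.2 (hanti i ⟨k, hlt⟩ h.le)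
        · exact le_rfl
    rw [← Finset.sum_filter, Finset.sum_sub_distrib, Finset.sum_sub_distrib, Finset.sum_const,
      Finset.sum_const, hcard, nsmul_eq_mul, nsmul_eq_mul, Finset.sum_filter] at hpos
    have hle : (S.card : ℝ) * c ≤ k * c :=
      mul_le_mul_of_nonneg_right (by exact_mod_cast hS) (h0 _)
    unfold partialSum
    linarith
  · simpa [partialSum] using
      Finset.sum_le_sum_of_subset_of_nonneg (Finset.subset_univ S) fun i _ _ => h0 i

/-- Averaging the rows of `A` against the probability vector `q` bounds its mass under `p ⊗ q`
by a partial sum of `p`. -/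
theorem sum_tensor_le_partialSum {n : ℕ} {p q : Fin n → ℝ} (hp : IsProbVec p) (hq : IsProbVec q)
    (A : Finset (Fin n × Fin n)) :
    ∑ ij ∈ A, p ij.1 * q ij.2 ≤ partialSum p (min A.card n) := by
  have hfib : ∀ j : Fin n, ∑ ij ∈ A with ij.2 = j, p ij.1 ≤ partialSum p (min A.card n) := by
    intro j
    have hinj : Set.InjOn Prod.fst (A.filter fun ij => ij.2 = j : Set (Fin n × Fin n)) := by
      intro x hx y hy hxy
      simp only [Finset.coe_filter, Set.mem_ofPred_eq] at hx hy
      exact Prod.ext hxy (hx.2.trans hy.2.symm)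
    rw [← Finset.sum_image (f := p) hinj]
    refine sum_le_partialSum hp.1 hp.2.1 (min_le_right _ _) (le_min ?_ ?_)
    · exact Finset.card_image_le.trans (Finset.card_filter_le _ _)
    · simpa using Finset.card_le_univ ((A.filter fun ij => ij.2 = j).image Prod.fst)
  calc ∑ ij ∈ A, p ij.1 * q ij.2
      = ∑ j, ∑ ij ∈ A with ij.2 = j, p ij.1 * q ij.2 := (Finset.sum_fiberwise _ _ _).symm
    _ = ∑ j, (∑ ij ∈ A with ij.2 = j, p ij.1) * q j := by
        refine Finset.sum_congr rfl fun j _ => ?_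
        rw [Finset.sum_mul]
        exact Finset.sum_congr rfl fun ij h => by rw [(Finset.mem_filter.1 h).2]
    _ ≤ ∑ j, partialSum p (min A.card n) * q j :=
        Finset.sum_le_sum fun j _ => mul_le_mul_of_nonneg_right (hfib j) (hq.1 j)
    _ = partialSum p (min A.card n) := by rw [← Finset.mul_sum, hq.2.2, mul_one]

/-- If `r` is the greatest lower bound `p ∧ q` in the majorization lattice, then the
product distribution `p ⊗ q` is majorized by `r`: the sum of the entries of `p ⊗ q`
over any set `A` of pairs is at most the sum of the first `min |A| n` entries of `r`. -/
theorem tensor_majorizedBy_glb {n : ℕ} (p q r : Fin n → ℝ)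
    (hp : IsProbVec p) (hq : IsProbVec q) (hr : IsProbVec r)
    (hglb : ∀ k : ℕ, k ≤ n → partialSum r k = min (partialSum p k) (partialSum q k)) :
    ∀ A : Finset (Fin n × Fin n),
      ∑ ij ∈ A, p ij.1 * q ij.2 ≤ partialSum r (min A.card n) := by
  intro A
  rw [hglb _ (min_le_right _ _)]
  refine le_min (sum_tensor_le_partialSum hp hq A) ?_
  have hswap := sum_tensor_le_partialSum hq hp (A.map (Equiv.prodComm _ _).toEmbedding)
  simpa [Finset.sum_map, mul_comm] using hswap
end

section
/- The Sharma–Mittal entropy S_{2,3} fails supermodularity on the majorization lattice: for p = (1/2, 3/10, 1/10, 1/10) and q = (2/5, 2/5, 1/5, 0) in P_4, the vector v = (2/5, 2/5, 1/10, 1/10) satisfies Σ_{i=1}^k v_i = min(Σ_{i=1}^k p_i, Σ_{i=1}^k q_i) for all k = 1, …, 4 (so v = p ∧ q), the vector u = (1/2, 3/10, 1/5, 0) is a least upper bound of p and q under majorization (p ⪯ u, q ⪯ u, and every w ∈ P_4 with p ⪯ w and q ⪯ w satisfies u ⪯ w), and S_{2,3}(u) + S_{2,3}(v) < S_{2,3}(p)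 + S_{2,3}(q), where S_{2,3}(x) = (1 − (Σ_{i=1}^4 x_i²)²)/2. -/
open Finset Real

/-- The Sharma–Mittal entropy `S_{2,3}(x) = (1 - (∑ xᵢ²)²)/2`. -/
noncomputable def SM23 (x : Fin 4 → ℝ) : ℝ := (1 - (∑ i, x i ^ 2) ^ 2) / 2

theorem partialSum_fin_four (x : Fin 4 → ℝ) :
    partialSum x 0 = 0 ∧ partialSum x 1 = x 0 ∧ partialSum x 2 = x 0 + x 1 ∧
      partialSum x 3 = x 0 + x 1 + x 2 ∧ partialSum x 4 = x 0 + x 1 + x 2 + x 3 := by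
  simp [partialSum, Fin.sum_univ_four]

theorem majorizedBy_fin_four_iff (x y : Fin 4 → ℝ) :
    MajorizedBy x y ↔ x 0 ≤ y 0 ∧ x 0 + x 1 ≤ y 0 + y 1 ∧
      x 0 + x 1 + x 2 ≤ y 0 + y 1 + y 2 ∧
      x 0 + x 1 + x 2 + x 3 ≤ y 0 + y 1 + y 2 + y 3 := by
  obtain ⟨hx0, hx1, hx2, hx3, hx4⟩ := partialSum_fin_four x
  obtain ⟨hy0, hy1, hy2, hy3, hy4⟩ := partialSum_fin_four y
  constructor
  · intro h
    have h1 := h 1 (by norm_num)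
    have h2 := h 2 (by norm_num)
    have h3 := h 3 (by norm_num)
    have h4 := h 4 (by norm_num)
    rw [hx1, hy1] at h1
    rw [hx2, hy2] at h2
    rw [hx3, hy3] at h3
    rw [hx4, hy4] at h4
    exact ⟨h1, h2, h3, h4⟩
  · rintro ⟨h1, h2, h3, h4⟩ k hk
    interval_cases k
    · rw [hx0, hy0]
    · rwa [hx1, hy1]
    · rwa [hx2, hy2]
    · rwa [hx3, hy3]
    · rwa [hx4, hy4]

theorem vec_four_apply_two (a b c d : ℝ) : ![a, b, c, d] 2 = c := rfl

theorem vec_four_apply_three (a b c d : ℝ) : ![a, b, c, d] 3 = d := rfl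

theorem isProbVec_vec_four {a b c d : ℝ} (hab : b ≤ a) (hbc : c ≤ b) (hcd : d ≤ c)
    (hd : 0 ≤ d) (hsum : a + b + c + d = 1) : IsProbVec ![a, b, c, d] := by
  refine ⟨fun i => ?_, fun i j hij => ?_, by simpa [Fin.sum_univ_four] using hsum⟩
  · fin_cases i <;> simp <;> linarith
  · fin_cases i <;> fin_cases j <;> simp at hij ⊢ <;> linarith

/-- `S_{2,3}` fails supermodularity on the majorization lattice: an explicit
counterexample with `p = (1/2, 3/10, 1/10, 1/10)` and `q = (2/5, 2/5, 1/5, 0)`. -/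
theorem sharmaMittal_not_supermodular :
    let p : Fin 4 → ℝ := ![1/2, 3/10, 1/10, 1/10]
    let q : Fin 4 → ℝ := ![2/5, 2/5, 1/5, 0]
    let v : Fin 4 → ℝ := ![2/5, 2/5, 1/10, 1/10]
    let u : Fin 4 → ℝ := ![1/2, 3/10, 1/5, 0]
    IsProbVec p ∧ IsProbVec q ∧ IsProbVec v ∧ IsProbVec u ∧
    (∀ k : ℕ, k ≤ 4 → partialSum v k = min (partialSum p k) (partialSum q k)) ∧
    MajorizedBy p u ∧ MajorizedBy q u ∧
    (∀ w : Fin 4 → ℝ, IsProbVec w → MajorizedBy p w → MajorizedBy q w →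
      MajorizedBy u w) ∧
    SM23 u + SM23 v < SM23 p + SM23 q := by
  intro p q v u
  refine ⟨?_, ?_, ?_, ?_, ?_, ?_, ?_, ?_, ?_⟩
  iterate 4
    · apply isProbVec_vec_four <;> norm_num
  · intro k hk
    obtain ⟨hp0, hp1, hp2, hp3, hp4⟩ := partialSum_fin_four p
    obtain ⟨hq0, hq1, hq2, hq3, hq4⟩ := partialSum_fin_four q
    obtain ⟨hv0, hv1, hv2, hv3, hv4⟩ := partialSum_fin_four v
    interval_cases k
    · rw [hp0, hq0, hv0, min_self]
    · rw [hp1, hq1, hv1]; norm_num [p, q, v, vec_four_apply_two, vec_four_apply_three]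
    · rw [hp2, hq2, hv2]; norm_num [p, q, v, vec_four_apply_two, vec_four_apply_three]
    · rw [hp3, hq3, hv3]; norm_num [p, q, v, vec_four_apply_two, vec_four_apply_three]
    · rw [hp4, hq4, hv4]; norm_num [p, q, v, vec_four_apply_two, vec_four_apply_three]
  · rw [majorizedBy_fin_four_iff]; norm_num [p, u, vec_four_apply_two, vec_four_apply_three]
  · rw [majorizedBy_fin_four_iff]; norm_num [q, u, vec_four_apply_two, vec_four_apply_three]
  · intro w _ hp hq
    rw [majorizedBy_fin_four_iff] at hp hq ⊢
    obtain ⟨hp1, hp2, -, -⟩ := hp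
    obtain ⟨-, -, hq3, hq4⟩ := hq
    refine ⟨hp1, hp2, le_trans ?_ hq3, le_trans ?_ hq4⟩ <;>
      norm_num [q, u, vec_four_apply_two, vec_four_apply_three]
  · norm_num [SM23, Fin.sum_univ_four, p, q, v, u, vec_four_apply_two, vec_four_apply_three]
end
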